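/- Let f be a positive integer and C_f : ℤ → ℂ a function with period f and mean value zero, i.e. Σ_{n=1}^{f} C_f(n) = 0. Then the series Σ_{n=1}^{∞} C_f(n) e^{−n² t} has, as t → 0+, the asymptotic expansion Σ_{k=0}^{∞} L(−2k, C_f) (−t)^k / k!, where L(−2k, C_f) = −( f^{2k} / (2k+1) ) Σ_{n=1}^{f} C_f(n) B_{2k+1}(n/f) and B_j(x) denotes the j-th Bernoulli polynomial. Precisely: for every nonnegative integer K there exist constants C > 0 and t_0 > 0 such that for all 0 < t < t_0, | Σ_{n=1}^{∞} C_f(n) e^{−n² t} − Σ_{k=0}^{K−1} L(−2k, C_f) (−t)^k / k! | ≤ C t^K. -/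

import Mathlib

open scoped BigOperators
open Finset Filter Topology MeasureTheory intervalIntegral

/-- A function with mean zero on the unit interval is bounded there by the `L¹` norm of its
derivative. -/
theorem abs_le_integral_abs_deriv_of_integral_eq_zero {h h' : ℝ → ℝ}
    (hd : ∀ u, HasDerivAt h (h' u) u) (hc : Continuous h') (h0 : ∫ u in (0 : ℝ)..1, h u = 0)
    {x : ℝ} (hx : x ∈ Set.Icc (0 : ℝ) 1) : |h x| ≤ ∫ u in (0 : ℝ)..1, |h' u| := by
  have hcont : Continuous h := continuous_iff_continuousAt.2 fun u => (hd u).continuousAt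
  have key : ∀ y ∈ Set.Icc (0 : ℝ) 1, |h x - h y| ≤ ∫ u in (0 : ℝ)..1, |h' u| := by
    intro y hy
    rw [← integral_eq_sub_of_hasDerivAt (fun u _ => hd u) (hc.intervalIntegrable y x)]
    refine (norm_integral_le_integral_norm_uIoc (f := h') (μ := volume)).trans ?_
    rw [intervalIntegral.integral_of_le zero_le_one]
    refine setIntegral_mono_set ?_ (ae_of_all _ fun u => abs_nonneg _) ?_
    · exact (hc.abs.intervalIntegrable 0 1).1
    · exact (Set.Ioc_subset_Ioc (le_min hy.1 hx.1) (max_le hy.2 hx.2)).eventuallyLE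
  have h1 : h x = ∫ y in (0 : ℝ)..1, (h x - h y) := by
    rw [intervalIntegral.integral_sub (by simp) (hcont.intervalIntegrable _ _), h0]
    simp
  rw [h1]
  have := intervalIntegral.norm_integral_le_of_norm_le_const (a := 0) (b := 1)
    (f := fun y => h x - h y) (C := ∫ u in (0 : ℝ)..1, |h' u|) fun y hy => by
      rw [Set.uIoc_of_le zero_le_one] at hy
      exact key y ⟨hy.1.le, hy.2⟩
  simpa using this

/-- The Euler–Maclaurin remainder on the unit interval has mean zero. -/
theorem integral_sub_integral_sub_sum_bernoulliFun (F : ℕ → ℝ → ℝ) (hF : Continuous (F 0))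
    (J : ℕ) :
    ∫ x in (0 : ℝ)..1, (F 0 x - (∫ u in (0 : ℝ)..1, F 0 u) -
      ∑ j ∈ range J, bernoulliFun (j + 1) x / (j + 1).factorial * (F j 1 - F j 0)) = 0 := by
  rw [intervalIntegral.integral_sub, intervalIntegral.integral_sub,
    intervalIntegral.integral_finsetSum]
  · have : ∀ j, ∫ x in (0 : ℝ)..1,
        bernoulliFun (j + 1) x / (j + 1).factorial * (F j 1 - F j 0) = 0 := by
      intro j
      rw [intervalIntegral.integral_mul_const, intervalIntegral.integral_div,
        integral_bernoulliFun_eq_zero j.succ_ne_zero]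
      simp
    simp [this]
  · intro j _
    exact (((continuous_bernoulliFun _).div_const _).mul_const _).intervalIntegrable _ _
  · exact hF.intervalIntegrable _ _
  · simp
  · exact (hF.sub continuous_const).intervalIntegrable _ _
  · exact (continuous_finsetSum _ fun j _ =>
      ((continuous_bernoulliFun _).div_const _).mul_const _).intervalIntegrable _ _

/-- The Euler–Maclaurin formula on the unit interval, where `F n` is the `n`-th derivative of
`F 0`. -/
theorem abs_sub_integral_sub_sum_bernoulliFun_le (J : ℕ) (F : ℕ → ℝ → ℝ)
    (hF : ∀ n u, HasDerivAt (F n) (F (n + 1) u) u) {x : ℝ} (hx : x ∈ Set.Icc (0 : ℝ) 1) :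
    |F 0 x - (∫ u in (0 : ℝ)..1, F 0 u) -
        ∑ j ∈ range J, bernoulliFun (j + 1) x / (j + 1).factorial * (F j 1 - F j 0)| ≤
      ∫ u in (0 : ℝ)..1, |F (J + 1) u| := by
  have hFc : ∀ n, Continuous (F n) := fun n =>
    continuous_iff_continuousAt.2 fun u => (hF n u).continuousAt
  induction J generalizing F x with
  | zero =>
    refine abs_le_integral_abs_deriv_of_integral_eq_zero (h' := F 1) (h := fun x => F 0 x -
      (∫ u in (0 : ℝ)..1, F 0 u) -
        ∑ j ∈ range 0, bernoulliFun (j + 1) x / (j + 1).factorial * (F j 1 - F j 0))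
      (fun u => ?_) (hFc 1) (integral_sub_integral_sub_sum_bernoulliFun F (hFc 0) 0) hx
    simpa using (hF 0 u).sub_const (∫ u in (0 : ℝ)..1, F 0 u)
  | succ J ih =>
    have hder : ∀ u, HasDerivAt (fun x => F 0 x - (∫ u in (0 : ℝ)..1, F 0 u) -
        ∑ j ∈ range (J + 1), bernoulliFun (j + 1) x / (j + 1).factorial * (F j 1 - F j 0))
        (F 1 u - (∫ u in (0 : ℝ)..1, F 1 u) -
        ∑ j ∈ range J,
          bernoulliFun (j + 1) u / (j + 1).factorial * (F (j + 1) 1 - F (j + 1) 0)) u := by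
      intro u
      have h1 : HasDerivAt (fun x => ∑ j ∈ range (J + 1),
          bernoulliFun (j + 1) x / (j + 1).factorial * (F j 1 - F j 0))
          (∑ j ∈ range (J + 1),
            bernoulliFun j u / j.factorial * (F j 1 - F j 0)) u := by
        refine HasDerivAt.fun_sum fun j _ => ?_
        have := ((hasDerivAt_bernoulliFun (j + 1) u).div_const
          ((j + 1).factorial : ℝ)).mul_const (F j 1 - F j 0)
        refine this.congr_deriv ?_
        rw [Nat.factorial_succ]
        have : (j.factorial : ℝ) ≠ 0 := by positivity
        have : (j : ℝ) + 1 ≠ 0 := by positivity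
        push_cast
        field_simp
      refine (((hF 0 u).sub_const (∫ u in (0 : ℝ)..1, F 0 u)).sub h1).congr_deriv ?_
      rw [sum_range_succ', integral_eq_sub_of_hasDerivAt (fun u _ => hF 0 u)
        ((hFc 1).intervalIntegrable 0 1)]
      simp
      ring
    have hcont : Continuous fun u => F 1 u - (∫ u in (0 : ℝ)..1, F 1 u) -
        ∑ j ∈ range J,
          bernoulliFun (j + 1) u / (j + 1).factorial * (F (j + 1) 1 - F (j + 1) 0) :=
      ((hFc 1).sub continuous_const).sub (continuous_finsetSum _ fun j _ =>
        ((continuous_bernoulliFun _).div_const _).mul_const _)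
    refine (abs_le_integral_abs_deriv_of_integral_eq_zero hder hcont
      (integral_sub_integral_sub_sum_bernoulliFun F (hFc 0) _) hx).trans ?_
    have := intervalIntegral.integral_mono_on zero_le_one (hcont.abs.intervalIntegrable 0 1)
      (intervalIntegrable_const (μ := volume) (c := ∫ u in (0 : ℝ)..1, |F (J + 1 + 1) u|))
      fun u hu => ih (fun n => F (n + 1)) (fun n => hF (n + 1)) hu fun n => hFc (n + 1)
    simpa using this

/-- The Euler–Maclaurin formula on `[0, N]`, where `F n` is the `n`-th derivative of `F 0`. -/
theorem abs_sum_sub_integral_sub_sum_bernoulliFun_le (J N : ℕ) (F : ℕ → ℝ → ℝ)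
    (hF : ∀ n u, HasDerivAt (F n) (F (n + 1) u) u) {x : ℝ} (hx : x ∈ Set.Icc (0 : ℝ) 1) :
    |∑ m ∈ range N, F 0 (m + x) - (∫ u in (0 : ℝ)..N, F 0 u) -
        ∑ j ∈ range J, bernoulliFun (j + 1) x / (j + 1).factorial * (F j N - F j 0)| ≤
      ∫ u in (0 : ℝ)..N, |F (J + 1) u| := by
  have hFc : ∀ n, Continuous (F n) := fun n =>
    continuous_iff_continuousAt.2 fun u => (hF n u).continuousAt
  induction N with
  | zero => simp
  | succ N ih =>
    have step := abs_sub_integral_sub_sum_bernoulliFun_le J (fun n u => F n (N + u))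
      (fun n u => (hF n (N + u)).comp_const_add (N : ℝ) u) hx
    simp only [integral_comp_add_left (fun u => F 0 u) (N : ℝ),
      integral_comp_add_left (fun u => |F (J + 1) u|) (N : ℝ), add_zero] at step
    push_cast
    rw [sum_range_succ, ← integral_add_adjacent_intervals (b := (N : ℝ))
      ((hFc 0).intervalIntegrable _ _) ((hFc 0).intervalIntegrable _ _),
      ← integral_add_adjacent_intervals (b := (N : ℝ))
      ((hFc (J + 1)).abs.intervalIntegrable _ _) ((hFc (J + 1)).abs.intervalIntegrable _ _)]
    refine le_trans (le_of_eq ?_) ((abs_add_le _ _).trans (add_le_add ih step))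
    have hsum : ∑ j ∈ range J,
          bernoulliFun (j + 1) x / (j + 1).factorial * (F j (N + 1) - F j 0) =
        ∑ j ∈ range J, bernoulliFun (j + 1) x / (j + 1).factorial * (F j N - F j 0) +
        ∑ j ∈ range J, bernoulliFun (j + 1) x / (j + 1).factorial * (F j (N + 1) - F j N) := by
      rw [← sum_add_distrib]
      exact sum_congr rfl fun j _ => by ring
    rw [hsum]
    congr 1
    ring

/-- The `n`-th derivative of `y ↦ exp (-y ^ 2)`. -/
noncomputable def gaussianDeriv : ℕ → ℝ → ℝ
  | 0, y => Real.exp (-y ^ 2)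
  | 1, y => -2 * y * Real.exp (-y ^ 2)
  | n + 2, y => -2 * y * gaussianDeriv (n + 1) y - 2 * (n + 1) * gaussianDeriv n y

theorem hasDerivAt_gaussianDeriv (n : ℕ) (y : ℝ) :
    HasDerivAt (gaussianDeriv n) (gaussianDeriv (n + 1) y) y := by
  induction n using Nat.twoStepInduction with
  | zero =>
    have := ((hasDerivAt_id y).pow 2).neg.exp
    refine (this.congr_of_eventuallyEq (.of_forall fun z => ?_)).congr_deriv ?_
    · simp [gaussianDeriv]
    · simp [gaussianDeriv]; ring
  | one =>
    have := ((hasDerivAt_id y).const_mul (-2)).mul ((hasDerivAt_id y).pow 2).neg.exp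
    refine (this.congr_of_eventuallyEq (.of_forall fun z => ?_)).congr_deriv ?_
    · simp [gaussianDeriv]
    · simp [gaussianDeriv]; ring
  | more n h0 h1 =>
    have := (((hasDerivAt_id y).const_mul (-2)).mul h1).sub (h0.const_mul (2 * ((n : ℝ) + 1)))
    refine (this.congr_of_eventuallyEq (.of_forall fun z => ?_)).congr_deriv ?_
    · simp [gaussianDeriv]
    · simp only [gaussianDeriv, id]; push_cast; ring

theorem tendsto_pow_mul_gaussianDeriv (n k : ℕ) :
    Tendsto (fun y => y ^ k * gaussianDeriv n y) atTop (𝓝 0) := by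
  have base : ∀ k : ℕ, Tendsto (fun y : ℝ => y ^ k * Real.exp (-y ^ 2)) atTop (𝓝 0) := by
    intro k
    refine squeeze_zero' ?_ ?_ (Real.tendsto_pow_mul_exp_neg_atTop_nhds_zero k)
    · filter_upwards [eventually_ge_atTop 0] with y hy
      positivity
    · filter_upwards [eventually_ge_atTop 1] with y hy
      gcongr
      nlinarith
  induction n using Nat.twoStepInduction generalizing k with
  | zero => exact base k
  | one =>
    refine ((base (k + 1)).const_mul (-2)).congr' (.of_forall fun y => ?_) |>.trans (by simp)
    simp only [gaussianDeriv]; ring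
  | more n h0 h1 =>
    refine (((h1 (k + 1)).const_mul (-2)).sub ((h0 k).const_mul (2 * ((n : ℝ) + 1)))).congr'
      (.of_forall fun y => ?_) |>.trans (by simp)
    simp only [gaussianDeriv]; ring

theorem integrable_pow_mul_gaussianDeriv (n k : ℕ) :
    Integrable (fun y => y ^ k * gaussianDeriv n y) := by
  have base : ∀ k : ℕ, Integrable (fun y : ℝ => y ^ k * Real.exp (-y ^ 2)) := by
    intro k
    simpa using integrable_rpow_mul_exp_neg_mul_sq one_pos
      (show (-1 : ℝ) < k by linarith [k.cast_nonneg (α := ℝ)])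
  induction n using Nat.twoStepInduction generalizing k with
  | zero => exact base k
  | one =>
    refine ((base (k + 1)).const_mul (-2)).congr (.of_forall fun y => ?_)
    simp only [gaussianDeriv]; ring
  | more n h0 h1 =>
    refine (((h1 (k + 1)).const_mul (-2)).sub ((h0 k).const_mul (2 * ((n : ℝ) + 1)))).congr
      (.of_forall fun y => ?_)
    simp only [gaussianDeriv, Pi.sub_apply]; ring

theorem gaussianDeriv_two_mul_add_one_zero (k : ℕ) : gaussianDeriv (2 * k + 1) 0 = 0 := by
  induction k with
  | zero => simp [gaussianDeriv]
  | succ k ih => simp [mul_add, gaussianDeriv, ih]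

theorem gaussianDeriv_two_mul_zero (k : ℕ) :
    gaussianDeriv (2 * k) 0 = (-1) ^ k * (2 * k).factorial / k.factorial := by
  induction k with
  | zero => simp [gaussianDeriv]
  | succ k ih =>
    rw [mul_add, mul_one, gaussianDeriv, ih, Nat.factorial_succ, Nat.factorial_succ,
      Nat.factorial_succ]
    push_cast
    field_simp
    ring

/-- The Euler–Maclaurin formula for sums of `exp (-(s * (m + x)) ^ 2)`, with an error term
uniform in the length of the sum. -/
theorem abs_sum_exp_neg_sq_sub_le (J N : ℕ) {s : ℝ} (hs : 0 < s) {x : ℝ}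
    (hx : x ∈ Set.Icc (0 : ℝ) 1) :
    |∑ m ∈ range N, Real.exp (-(s * (m + x)) ^ 2) -
        (∫ u in (0 : ℝ)..N, Real.exp (-(s * u) ^ 2)) -
        ∑ j ∈ range J, bernoulliFun (j + 1) x / (j + 1).factorial *
          (s ^ j * gaussianDeriv j (s * N) - s ^ j * gaussianDeriv j 0)| ≤
      s ^ J * ∫ y, |gaussianDeriv (J + 1) y| := by
  have h := abs_sum_sub_integral_sub_sum_bernoulliFun_le J N
    (fun n u => s ^ n * gaussianDeriv n (s * u)) (fun n u => by
      have := ((hasDerivAt_gaussianDeriv n (s * u)).comp u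
        ((hasDerivAt_id u).const_mul s)).const_mul (s ^ n)
      exact this.congr_deriv (by ring)) hx
  simp only [pow_zero, one_mul, gaussianDeriv, mul_zero] at h
  refine h.trans ?_
  have hint : Integrable fun y => |gaussianDeriv (J + 1) y| := by
    simpa using (integrable_pow_mul_gaussianDeriv (J + 1) 0).abs
  simp only [abs_mul, abs_pow, abs_of_pos hs]
  rw [intervalIntegral.integral_const_mul,
    integral_comp_mul_left (fun u => |gaussianDeriv (J + 1) u|) hs.ne', smul_eq_mul, pow_succ,
    mul_assoc, mul_inv_cancel_left₀ hs.ne']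
  gcongr
  rw [intervalIntegral.integral_of_le (by rw [mul_zero]; positivity)]
  exact setIntegral_le_integral hint (.of_forall fun y => abs_nonneg _)

theorem sum_bernoulliFun_mul_gaussianDeriv_zero (K : ℕ) (s x : ℝ) :
    ∑ j ∈ range (2 * K), bernoulliFun (j + 1) x / (j + 1).factorial * (s ^ j * gaussianDeriv j 0) =
      ∑ k ∈ range K, bernoulliFun (2 * k + 1) x / (2 * k + 1) * (-s ^ 2) ^ k / k.factorial := by
  induction K with
  | zero => simp
  | succ K ih =>
    rw [mul_add, mul_one, sum_range_succ, sum_range_succ, ih, sum_range_succ,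
      gaussianDeriv_two_mul_add_one_zero, gaussianDeriv_two_mul_zero, Nat.factorial_succ (2 * K),
      neg_pow (s ^ 2), ← pow_mul]
    push_cast
    field_simp
    ring

theorem sum_range_mul_eq_sum_sum {M : Type*} [AddCommMonoid M] (a : ℕ → M) (f N : ℕ) :
    ∑ n ∈ range (f * N), a n = ∑ r ∈ range f, ∑ m ∈ range N, a (f * m + r) := by
  rw [sum_comm]
  induction N with
  | zero => simp
  | succ N ih => rw [mul_add, mul_one, sum_range_add, ih, sum_range_succ]

theorem summable_periodic_mul_exp_neg_sq {f : ℕ} (hf : 0 < f) {c : ℕ → ℂ}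
    (hc : Function.Periodic c f) {t : ℝ} (ht : 0 < t) :
    Summable fun n : ℕ => c n * (Real.exp (-(((n : ℝ) + 1) ^ 2) * t) : ℝ) := by
  have hbound : ∀ n, ‖c n‖ ≤ ∑ r ∈ range f, ‖c r‖ := fun n => by
    rw [← hc.map_mod_nat n]
    exact single_le_sum (f := fun r => ‖c r‖) (fun _ _ => norm_nonneg _)
      (mem_range.2 (n.mod_lt hf))
  have hexp : Summable fun n : ℕ => Real.exp (-(((n : ℝ) + 1) ^ 2) * t) := by
    refine .of_nonneg_of_le (fun n => (Real.exp_pos _).le) (fun n => ?_)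
      (Real.summable_exp_nat_mul_iff.2 (neg_neg_of_pos ht))
    refine Real.exp_le_exp.2 ?_
    nlinarith [n.cast_nonneg (α := ℝ), mul_nonneg ht.le (sq_nonneg (n : ℝ)),
      mul_nonneg ht.le (n.cast_nonneg (α := ℝ))]
  refine .of_norm_bounded (hexp.mul_left (∑ r ∈ range f, ‖c r‖)) fun n => ?_
  rw [norm_mul, Complex.norm_real, Real.norm_of_nonneg (Real.exp_pos _).le]
  gcongr
  exact hbound n

/-- The asymptotic expansion with an explicit error term, for periodic mean-zero coefficients. -/
theorem norm_tsum_periodic_mul_exp_neg_sq_sub_le {f : ℕ} (hf : 0 < f) {c : ℕ → ℂ}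
    (hc : Function.Periodic c f) (hmean : ∑ n ∈ range f, c n = 0) (K : ℕ) {t : ℝ} (ht : 0 < t) :
    ‖(∑' n : ℕ, c n * (Real.exp (-(((n : ℝ) + 1) ^ 2) * t) : ℝ)) +
        ∑ r ∈ range f, c r * (∑ k ∈ range K, bernoulliFun (2 * k + 1) ((r + 1) / f) /
          (2 * k + 1) * (-(f * √t) ^ 2) ^ k / k.factorial : ℝ)‖ ≤
      (∑ r ∈ range f, ‖c r‖) * ((f * √t) ^ (2 * K) * ∫ y, |gaussianDeriv (2 * K + 1) y|) := by
  set s : ℝ := f * √t with hs_def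
  have hfR : (0 : ℝ) < f := Nat.cast_pos.2 hf
  have hs : 0 < s := by positivity
  set x : ℕ → ℝ := fun r => (r + 1) / f with hx_def
  have hx : ∀ r ∈ range f, x r ∈ Set.Icc (0 : ℝ) 1 := fun r hr => by
    refine ⟨by positivity, (div_le_one hfR).2 ?_⟩
    exact_mod_cast mem_range.1 hr
  set A : ℕ → ℕ → ℝ := fun r N => ∑ m ∈ range N, Real.exp (-(s * (m + x r)) ^ 2) with hA
  set T : ℕ → ℕ → ℝ := fun r N => ∑ j ∈ range (2 * K), bernoulliFun (j + 1) (x r) /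
    (j + 1).factorial * (s ^ j * gaussianDeriv j (s * N) - s ^ j * gaussianDeriv j 0) with hT
  have hpartial : ∀ N, ∑ n ∈ range (f * N), c n * (Real.exp (-(((n : ℝ) + 1) ^ 2) * t) : ℝ) =
      ∑ r ∈ range f, c r * A r N := by
    intro N
    rw [sum_range_mul_eq_sum_sum]
    refine sum_congr rfl fun r _ => ?_
    rw [hA, Complex.ofReal_sum, mul_sum]
    refine sum_congr rfl fun m _ => ?_
    have hcm : c (f * m + r) = c r := by
      rw [← hc.map_mod_nat, Nat.mul_add_mod, hc.map_mod_nat]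
    have hexp : -(((f * m + r : ℕ) : ℝ) + 1) ^ 2 * t = -(s * (m + x r)) ^ 2 := by
      have : s * (m + x r) = √t * (((f * m + r : ℕ) : ℝ) + 1) := by
        rw [hs_def, hx_def]
        push_cast
        field_simp
        ring
      rw [this, mul_pow, Real.sq_sqrt ht.le]
      ring
    rw [hcm, hexp]
  have hbound : ∀ N, ‖∑ n ∈ range (f * N), c n * (Real.exp (-(((n : ℝ) + 1) ^ 2) * t) : ℝ) -
      ∑ r ∈ range f, c r * T r N‖ ≤
      (∑ r ∈ range f, ‖c r‖) * (s ^ (2 * K) * ∫ y, |gaussianDeriv (2 * K + 1) y|) := by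
    intro N
    have hI : ∑ n ∈ range (f * N), c n * (Real.exp (-(((n : ℝ) + 1) ^ 2) * t) : ℝ) -
        ∑ r ∈ range f, c r * T r N = ∑ r ∈ range f, c r *
          (A r N - (∫ u in (0 : ℝ)..N, Real.exp (-(s * u) ^ 2)) - T r N : ℝ) := by
      have hzero : ∑ r ∈ range f, c r * (∫ u in (0 : ℝ)..N, Real.exp (-(s * u) ^ 2) : ℝ) = 0 := by
        rw [← sum_mul, hmean, zero_mul]
      simp only [Complex.ofReal_sub, mul_sub, sum_sub_distrib]
      rw [hpartial, hzero, sub_zero]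
    rw [hI, sum_mul]
    refine (norm_sum_le _ _).trans (sum_le_sum fun r hr => ?_)
    rw [norm_mul, Complex.norm_real, Real.norm_eq_abs]
    gcongr
    exact abs_sum_exp_neg_sq_sub_le (2 * K) N hs (hx r hr)
  have hTlim : ∀ r, Tendsto (fun N => T r N) atTop (𝓝 (-∑ k ∈ range K,
      bernoulliFun (2 * k + 1) (x r) / (2 * k + 1) * (-s ^ 2) ^ k / k.factorial)) := by
    intro r
    rw [← sum_bernoulliFun_mul_gaussianDeriv_zero, ← sum_neg_distrib]
    refine tendsto_finsetSum _ fun j _ => ?_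
    have hG : Tendsto (fun N : ℕ => gaussianDeriv j (s * N)) atTop (𝓝 0) := by
      have := tendsto_pow_mul_gaussianDeriv j 0
      simp only [pow_zero, one_mul] at this
      exact this.comp (tendsto_natCast_atTop_atTop.const_mul_atTop hs)
    convert! ((hG.const_mul (s ^ j)).sub_const (s ^ j * gaussianDeriv j 0)).const_mul
      (bernoulliFun (j + 1) (x r) / (j + 1).factorial) using 2
    ring
  have hlim := (((summable_periodic_mul_exp_neg_sq hf hc ht).hasSum.tendsto_sum_nat.comp
    (tendsto_id.const_mul_atTop' hf)).sub (tendsto_finsetSum (range f) fun r _ =>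
      ((Complex.continuous_ofReal.tendsto _).comp (hTlim r)).const_mul (c r))).norm
  refine le_trans (le_of_eq ?_) (le_of_tendsto hlim (.of_forall hbound))
  congr 1
  simp [sub_eq_add_neg, hx_def]

/-- Let `f ≥ 1` and `C_f : ℤ → ℂ` be `f`-periodic with mean value `0`.
Then `Σ_{n≥1} C_f(n) e^{−n²t}` has, as `t → 0+`, the asymptotic expansion
`Σ_k L(−2k, C_f) (−t)^k/k!`, where
`L(−2k, C_f) = −(f^{2k}/(2k+1)) Σ_{n=1}^{f} C_f(n) B_{2k+1}(n/f)`: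
for every `K` there are `C > 0` and `t₀ > 0` such that for `0 < t < t₀` the error after
`K` terms is at most `C t^K`. -/
theorem stmt10 (f : ℕ) (hf : 0 < f) (C_f : ℤ → ℂ)
    (hper : ∀ n : ℤ, C_f (n + f) = C_f n)
    (hmean : ∑ n ∈ Finset.range f, C_f ((n : ℤ) + 1) = 0) :
    ∀ K : ℕ, ∃ C : ℝ, 0 < C ∧ ∃ t₀ : ℝ, 0 < t₀ ∧ ∀ t : ℝ, 0 < t → t < t₀ →
      ‖(∑' n : ℕ, C_f ((n : ℤ) + 1) * (Real.exp (-(((n : ℝ) + 1) ^ 2) * t) : ℝ)) -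
          ∑ k ∈ Finset.range K,
            (-((f : ℂ) ^ (2 * k) / (2 * k + 1)) *
                ∑ n ∈ Finset.range f,
                  C_f ((n : ℤ) + 1) *
                    (((Polynomial.bernoulli (2 * k + 1)).eval
                        (((n : ℚ) + 1) / (f : ℚ)) : ℚ) : ℂ)) *
              (-(t : ℂ)) ^ k / (k.factorial : ℂ)‖ ≤ C * t ^ K := by
  intro K
  set M : ℝ := (∑ r ∈ range f, ‖C_f ((r : ℤ) + 1)‖) *
    ((f : ℝ) ^ (2 * K) * ∫ y, |gaussianDeriv (2 * K + 1) y|) with hM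
  have hM0 : 0 ≤ M := by positivity
  refine ⟨M + 1, by positivity, 1, one_pos, fun t ht _ => ?_⟩
  have hc : Function.Periodic (fun n : ℕ => C_f ((n : ℤ) + 1)) f := fun n => by
    simp only [Nat.cast_add]
    rw [add_right_comm, hper]
  have hB : ∀ j n : ℕ, (((Polynomial.bernoulli j).eval (((n : ℚ) + 1) / (f : ℚ)) : ℚ) : ℂ) =
      (bernoulliFun j (((n : ℝ) + 1) / f) : ℝ) := by
    intro j n
    have : bernoulliFun j (((n : ℝ) + 1) / f) =
        ((Polynomial.bernoulli j).eval (((n : ℚ) + 1) / (f : ℚ)) : ℚ) := by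
      rw [bernoulliFun, ← eq_ratCast (algebraMap ℚ ℝ), ← Polynomial.eval_map_apply]
      simp
    rw [this, Complex.ofReal_ratCast]
  have hmain := norm_tsum_periodic_mul_exp_neg_sq_sub_le hf hc hmean K ht
  have hrhs : (∑ r ∈ range f, ‖C_f ((r : ℤ) + 1)‖) *
      ((f * √t) ^ (2 * K) * ∫ y, |gaussianDeriv (2 * K + 1) y|) = M * t ^ K := by
    rw [hM, mul_pow, pow_mul (√t), Real.sq_sqrt ht.le]
    ring
  rw [hrhs] at hmain
  refine le_trans (le_of_eq ?_) (hmain.trans (by gcongr; linarith))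
  rw [sub_eq_add_neg, ← sum_neg_distrib]
  congr 2
  simp only [Complex.ofReal_sum, mul_sum]
  rw [sum_comm]
  refine sum_congr rfl fun k _ => ?_
  rw [sum_mul, sum_div, ← sum_neg_distrib]
  refine sum_congr rfl fun n _ => ?_
  rw [hB, mul_pow (f : ℝ), Real.sq_sqrt ht.le, neg_mul_eq_mul_neg, mul_pow]
  push_cast
  ring
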